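/- Let G be a connected simple graph with vertex labeling l : V(G) → ℝ≥0 and let d_l be the distance generated by G(l). Then d_l is a pseudoultrametric on V(G). -/

import Mathlib

open Classical in
/-- The distance `d_l` generated by a labeled graph `G(l)`:
`d_l x x = 0` and, for `x ≠ y`,
`d_l x y = inf over paths P joining x and y of (max_{v ∈ V(P)} l v)`. -/
noncomputable def labelDist {V : Type*} (G : SimpleGraph V) (l : V → NNReal)
    (x y : V) : NNReal :=
  if x = y then 0
  else ⨅ p : {p : G.Walk x y // p.IsPath}, (p.1.support.map l).foldr max 0

theorem List.foldr_max_zero_lt_iff {c : NNReal} (hc : 0 < c) (s : List NNReal) :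
    s.foldr max 0 < c ↔ ∀ a ∈ s, a < c := by
  induction s with
  | nil => simpa using hc
  | cons a s ih => simp [ih]

theorem labelDist_self {V : Type*} (G : SimpleGraph V) (l : V → NNReal) (x : V) :
    labelDist G l x x = 0 := if_pos rfl

theorem labelDist_lt_iff {V : Type*} {G : SimpleGraph V} (hG : G.Connected) (l : V → NNReal)
    {x y : V} (hxy : x ≠ y) {c : NNReal} :
    labelDist G l x y < c ↔ ∃ p : G.Walk x y, ∀ v ∈ p.support, l v < c := by
  classical
  obtain ⟨q, hq⟩ := hG.exists_isPath x y
  have : Nonempty {p : G.Walk x y // p.IsPath} := ⟨⟨q, hq⟩⟩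
  rw [labelDist, if_neg hxy, ciInf_lt_iff (OrderBot.bddBelow _)]
  constructor
  · rintro ⟨p, hp⟩
    refine ⟨p.1, fun v hv => ?_⟩
    exact (List.foldr_max_zero_lt_iff (bot_le.trans_lt hp) _).1 hp _ (List.mem_map_of_mem hv)
  · rintro ⟨p, hp⟩
    have hc : 0 < c := bot_le.trans_lt (hp x p.start_mem_support)
    refine ⟨⟨p.bypass, p.bypass_isPath⟩, (List.foldr_max_zero_lt_iff hc _).2 fun a ha => ?_⟩
    obtain ⟨v, hv, rfl⟩ := List.mem_map.1 ha
    exact hp v (p.support_bypass_subset_support hv)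

theorem labelDist_comm {V : Type*} {G : SimpleGraph V} (hG : G.Connected) (l : V → NNReal)
    (x y : V) : labelDist G l x y = labelDist G l y x := by
  rcases eq_or_ne x y with rfl | hxy
  · rfl
  refine eq_of_forall_gt_iff fun c => ?_
  rw [labelDist_lt_iff hG l hxy, labelDist_lt_iff hG l hxy.symm]
  exact ⟨fun ⟨p, hp⟩ => ⟨p.reverse, by simpa using hp⟩,
    fun ⟨p, hp⟩ => ⟨p.reverse, by simpa using hp⟩⟩

theorem labelDist_le_max {V : Type*} {G : SimpleGraph V} (hG : G.Connected) (l : V → NNReal)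
    (x y z : V) : labelDist G l x y ≤ max (labelDist G l x z) (labelDist G l z y) := by
  rcases eq_or_ne x y with rfl | hxy
  · simp [labelDist_self]
  rcases eq_or_ne x z with rfl | hxz
  · exact le_max_right _ _
  rcases eq_or_ne z y with rfl | hzy
  · exact le_max_left _ _
  refine le_of_forall_gt fun c hc => ?_
  obtain ⟨h₁, h₂⟩ := max_lt_iff.1 hc
  obtain ⟨p, hp⟩ := (labelDist_lt_iff hG l hxz).1 h₁
  obtain ⟨q, hq⟩ := (labelDist_lt_iff hG l hzy).1 h₂
  refine (labelDist_lt_iff hG l hxy).2 ⟨p.append q, fun v hv => ?_⟩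
  exact (SimpleGraph.Walk.mem_support_append_iff p q |>.1 hv).elim (hp v) (hq v)

/-- For a connected labeled graph `G(l)`, the distance `d_l` is a
pseudoultrametric on `V(G)`. -/
theorem labelDist_isPseudoUltrametric {V : Type*} (G : SimpleGraph V)
    (hc : G.Connected) (l : V → NNReal) :
    (∀ x, labelDist G l x x = 0) ∧
    (∀ x y, labelDist G l x y = labelDist G l y x) ∧
    (∀ x y z,
      labelDist G l x y ≤ max (labelDist G l x z) (labelDist G l z y)) :=
  ⟨labelDist_self G l, labelDist_comm hc l, labelDist_le_max hc l⟩
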